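/- In the setting of the shifted mollifier K^ε above, let Θ ∈ C(Ω̄ × ℝ^{N×n}) be such that Θ(x,·) is convex with Θ(x,·) ≥ Θ(x,0) = 0 for all x ∈ Ω̄, and Θ_P exists and is continuous. Let u ∈ W_0^{1,∞}(Ω;ℝ^N). Then there is a modulus of continuity ω (independent of ε and x) such that for all x ∈ Ω and ε ∈ (0,ε₀): Θ(x, D(K^ε u)(x)) ≤ ess sup_{Ω ∩ B_ε(x+εℓξ(x))} Θ(·, Du) + ω(ε). In particular ‖Θ(·, D(K^ε u))‖_{L^∞(Ω)} ≤ ‖Θ(·, Du)‖_{L^∞(Ω)} + ω(ε). -/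

import Mathlib

open MeasureTheory
open scoped ENNReal NNReal Topology

/-- A continuous function on a normed space admits a modulus of continuity at the points of a
compact set. -/
theorem Continuous.exists_modulus_of_isCompact {E : Type*} [NormedAddCommGroup E]
    [NormedSpace ℝ E] [ProperSpace E] {f : E → ℝ} (hf : Continuous f) {K : Set E}
    (hK : IsCompact K) :
    ∃ ω : ℝ → ℝ, Continuous ω ∧ ω 0 = 0 ∧ Monotone ω ∧ (∀ t, 0 ≤ ω t) ∧
      ∀ p ∈ K, ∀ q, |f q - f p| ≤ ω (dist q p) := by
  set g : ℝ → E × E → ℝ := fun t z => |f (z.1 + max t 0 • z.2) - f z.1| with hg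
  have hgc : Continuous (Function.uncurry g) := by
    simp only [hg, Function.uncurry_def]
    fun_prop
  have hKB : IsCompact (K ×ˢ Metric.closedBall (0 : E) 1) := hK.prod (isCompact_closedBall 0 1)
  set S : Set (E × E) := K ×ˢ Metric.closedBall (0 : E) 1 with hS
  have hbdd : ∀ t, BddAbove (g t '' S) := fun t =>
    (hKB.image (hgc.comp (Continuous.prodMk_right t))).bddAbove
  have hnn : ∀ t, 0 ≤ sSup (g t '' S) := fun t =>
    Real.sSup_nonneg (by rintro _ ⟨z, -, rfl⟩; exact abs_nonneg _)
  refine ⟨fun t => sSup (g t '' S), hKB.continuous_sSup hgc, ?_, ?_, hnn, ?_⟩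
  · refine le_antisymm (Real.sSup_le ?_ le_rfl) (hnn 0)
    rintro _ ⟨z, -, rfl⟩
    simp [hg]
  · intro s t hst
    refine Real.sSup_le ?_ (hnn t)
    rintro _ ⟨⟨p, v⟩, ⟨hp, hv⟩, rfl⟩
    rcases le_or_gt s 0 with hs | hs
    · simpa [hg, max_eq_right hs] using hnn t
    · have ht : 0 < t := hs.trans_le hst
      refine le_csSup (hbdd t) ⟨(p, (s / t) • v), ⟨hp, ?_⟩, ?_⟩
      · simp only [Metric.mem_closedBall, dist_zero_right, norm_smul] at hv ⊢
        rw [Real.norm_of_nonneg (by positivity)]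
        exact mul_le_one₀ ((div_le_one ht).2 hst) (norm_nonneg _) hv
      · simp [hg, max_eq_left hs.le, max_eq_left ht.le, smul_smul, mul_div_cancel₀ s ht.ne']
  · intro p hp q
    rcases eq_or_ne q p with rfl | hqp
    · simpa using hnn 0
    · have hd : 0 < ‖q - p‖ := norm_pos_iff.2 (sub_ne_zero.2 hqp)
      refine le_csSup (hbdd _) ⟨(p, ‖q - p‖⁻¹ • (q - p)), ⟨hp, ?_⟩, ?_⟩
      · simp [norm_smul, hd.ne']
      · simp [hg, dist_eq_norm, smul_smul, hd.ne']

theorem essSup_le_of_ae_le_of_nonneg {α : Type*} [MeasurableSpace α] {μ : Measure α}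
    {f : α → ℝ} {c : ℝ} (hc : 0 ≤ c) (hf : ∀ᵐ x ∂μ, f x ≤ c) : essSup f μ ≤ c := by
  rw [essSup, Filter.limsup_eq]
  by_cases hb : BddBelow {a | ∀ᵐ x ∂μ, f x ≤ a}
  · exact csInf_le hb hf
  · rwa [Real.sInf_of_not_bddBelow hb]

theorem essSup_nonneg_of_nonneg {α : Type*} [MeasurableSpace α] {μ : Measure α}
    {f : α → ℝ} (hf : ∀ x, 0 ≤ f x) : 0 ≤ essSup f μ := by
  rw [essSup, Filter.limsup_eq]
  rcases eq_or_ne μ 0 with rfl | hμ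
  · simp
  · have : NeZero μ := ⟨hμ⟩
    refine Real.sInf_nonneg fun a ha => ?_
    obtain ⟨x, hx⟩ := (show ∀ᵐ x ∂μ, f x ≤ a from ha).exists
    exact (hf x).trans hx

section
variable {E F : Type*} [NormedAddCommGroup E] [NormedSpace ℝ E] [FiniteDimensional ℝ E]
  [MeasurableSpace E] [BorelSpace E] [NormedAddCommGroup F] [NormedSpace ℝ F]
  {μ : Measure E} [μ.IsAddHaarMeasure]

theorem ae_fderiv_eq_zero_of_eqOn_zero_real {h : E → ℝ} {Dh : E → E →L[ℝ] ℝ} {s : Set E}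
    (hs : MeasurableSet s) (hh : ∀ x ∈ s, h x = 0) (hDh : ∀ᵐ x ∂μ, HasFDerivAt h (Dh x) x) :
    ∀ᵐ x ∂μ, x ∈ s → Dh x = 0 := by
  rcases subsingleton_or_nontrivial E with hE | hE
  · exact Filter.Eventually.of_forall fun x _ => Subsingleton.elim _ _
  obtain ⟨v, hv⟩ := exists_ne (0 : E)
  obtain ⟨t, ht, htm, htn⟩ := exists_measurable_superset_of_null (ae_iff.1 hDh)
  have hDh' : ∀ x ∉ t, HasFDerivAt h (Dh x) x := fun x hx => by
    by_contra hc
    exact hx (ht hc)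
  have happ : ApproximatesLinearOn (fun x => h x • v) (0 : E →L[ℝ] E) (s \ t) 0 := by
    intro x hx y hy
    simp [hh x hx.1, hh y hy.1]
  have key := happ.norm_fderiv_sub_le μ (hs.diff htm) (fun x => (Dh x).smulRight v)
    fun x hx => ((hDh' x hx.2).smul_const v).hasFDerivWithinAt
  rw [ae_restrict_iff' (hs.diff htm)] at key
  filter_upwards [key, measure_eq_zero_iff_ae_notMem.1 htn] with x hx hxt hxs
  simpa [hv] using hx ⟨hxs, hxt⟩

/-- The derivative of a function vanishing on a measurable set is zero almost everywhere there. -/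
theorem ae_fderiv_eq_zero_of_eqOn_zero [FiniteDimensional ℝ F] {u : E → F} {Du : E → E →L[ℝ] F}
    {s : Set E} (hs : MeasurableSet s) (hu : ∀ x ∈ s, u x = 0)
    (hDu : ∀ᵐ x ∂μ, HasFDerivAt u (Du x) x) :
    ∀ᵐ x ∂μ, x ∈ s → Du x = 0 := by
  let b := Module.finBasis ℝ F
  let φ : Fin (Module.finrank ℝ F) → F →L[ℝ] ℝ := fun i => (b.coord i).toContinuousLinearMap
  have key : ∀ᵐ x ∂μ, ∀ i, x ∈ s → (φ i).comp (Du x) = 0 := ae_all_iff.2 fun i =>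
    ae_fderiv_eq_zero_of_eqOn_zero_real (h := fun x => φ i (u x)) hs
      (fun x hx => by simp [hu x hx])
      (hDu.mono fun x hx => (φ i).hasFDerivAt.comp x hx)
  filter_upwards [key] with x hx hxs
  ext w
  refine b.ext_elem fun i => ?_
  simpa [φ] using congrArg (fun A : E →L[ℝ] ℝ => A w) (hx i hxs)

theorem quasiMeasurePreserving_sub_smul (w : E) {r : ℝ} (hr : r ≠ 0) :
    Measure.QuasiMeasurePreserving (fun y => w - r • y) μ μ :=
  (Measure.measurePreserving_sub_left μ w).quasiMeasurePreserving.comp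
    (Measure.quasiMeasurePreserving_smul μ hr)

/-- Weighted averages of a bounded function with values in a closed convex set stay in the set. -/
theorem Convex.integral_smul_mem [CompleteSpace F] {α : Type*} [MeasurableSpace α]
    {ν : Measure α} {s : Set F} (hs : Convex ℝ s) (hsc : IsClosed s) {w : α → ℝ}
    (hw : Measurable w) (hw0 : ∀ y, 0 ≤ w y) (hw1 : ∫ y, w y ∂ν = 1) {f : α → F}
    (hfi : Integrable (fun y => w y • f y) ν) (hf : ∀ᵐ y ∂ν, w y ≠ 0 → f y ∈ s) :
    ∫ y, w y • f y ∂ν ∈ s := by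
  have hwi : Integrable w ν := by
    by_contra h
    simp [integral_undef h] at hw1
  have hm : Measurable fun y => (w y).toNNReal := hw.real_toNNReal
  have hco : ∀ y, (w y).toNNReal • f y = w y • f y := fun y => by
    rw [NNReal.smul_def, Real.coe_toNNReal _ (hw0 y)]
  let κ : Measure α := ν.withDensity fun y => ((w y).toNNReal : ℝ≥0∞)
  have : IsProbabilityMeasure κ := by
    constructor
    rw [withDensity_apply _ MeasurableSet.univ, Measure.restrict_univ]
    have := ofReal_integral_eq_lintegral_ofReal hwi (Filter.Eventually.of_forall hw0)
    rw [hw1, ENNReal.ofReal_one] at this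
    exact this.symm
  have key : ∫ y, f y ∂κ ∈ s := by
    refine hs.integral_mem hsc ?_ ?_
    · rw [ae_withDensity_iff hm.coe_nnreal_ennreal]
      filter_upwards [hf] with y hy h
      exact hy fun h0 => h (by simp [h0])
    · rw [integrable_withDensity_iff_integrable_smul hm]
      simpa only [hco] using hfi
  rw [integral_withDensity_eq_integral_smul hm] at key
  simpa only [hco] using key

/-- Differentiation of a mollification of a Lipschitz function, precomposed with a map `g`. -/
theorem hasFDerivAt_integral_smul_comp_sub_smul [CompleteSpace F] [SecondCountableTopology F]
    {ϱ : E → ℝ} (hϱ : Integrable ϱ μ) (hϱc : HasCompactSupport ϱ) (hϱcont : Continuous ϱ)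
    {u : E → F} {Du : E → E →L[ℝ] F} {L : ℝ≥0}
    (hu : LipschitzWith L u) (hDu : ∀ᵐ x ∂μ, HasFDerivAt u (Du x) x)
    {g : E → E} {C : ℝ≥0} (hg : LipschitzWith C g) {g' : E →L[ℝ] E} {x : E}
    (hg' : HasFDerivAt g g' x) {ε : ℝ} (hε : ε ≠ 0) :
    Integrable (fun y => ϱ y • (Du (g x - ε • y)).comp g') μ ∧
      HasFDerivAt (fun x => ∫ y, ϱ y • u (g x - ε • y) ∂μ)
        (∫ y, ϱ y • (Du (g x - ε • y)).comp g' ∂μ) x := by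
  have hq := quasiMeasurePreserving_sub_smul (μ := μ) (g x) hε
  have hcont : ∀ x, Continuous fun y => ϱ y • u (g x - ε • y) := fun x => by
    have := hu.continuous
    fun_prop
  have hDum : AEStronglyMeasurable Du μ := by
    have h1 : Measurable (fderiv ℝ u) := measurable_fderiv ℝ u
    refine h1.aestronglyMeasurable.congr ?_
    filter_upwards [hDu] with y hy using hy.fderiv
  refine hasFDerivAt_integral_of_dominated_loc_of_lip (s := Set.univ)
    (bound := fun y => ϱ y * (L * C)) Filter.univ_mem
    (Filter.Eventually.of_forall fun x => (hcont x).aestronglyMeasurable)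
    ((hcont x).integrable_of_hasCompactSupport hϱc.smul_right) ?_ ?_ (hϱ.mul_const _) ?_
  · refine hϱ.aestronglyMeasurable.smul ?_
    exact ((ContinuousLinearMap.compL ℝ E E F).flip g').continuous.comp_aestronglyMeasurable
      (hDum.comp_quasiMeasurePreserving hq)
  · refine Filter.Eventually.of_forall fun y => LipschitzOnWith.of_dist_le_mul fun a _ b _ => ?_
    rw [dist_smul₀, Real.coe_nnabs, abs_mul, ← Real.norm_eq_abs (ϱ y),
      abs_of_nonneg (by positivity : (0 : ℝ) ≤ L * C), mul_assoc]
    gcongr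
    calc dist (u (g a - ε • y)) (u (g b - ε • y))
        ≤ L * dist (g a - ε • y) (g b - ε • y) := hu.dist_le_mul _ _
      _ = L * dist (g a) (g b) := by rw [dist_sub_right]
      _ ≤ L * (C * dist a b) := by gcongr; exact hg.dist_le_mul _ _
      _ = L * C * dist a b := by ring
  · filter_upwards [hq.ae hDu] with y hy
    exact (hy.comp x (hg'.sub_const (ε • y))).const_smul (ϱ y)

end

/-- Key approximation estimate for the shifted mollifier: for `Θ(x,·)` convex with
`Θ(x,·) ≥ Θ(x,0) = 0` and `Θ, Θ_P` continuous, there is a modulus of continuity `ω`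
(independent of `ε` and `x`) with
`Θ(x, D(K^ε u)(x)) ≤ ess sup_{Ω ∩ B_ε(x+εℓξ(x))} Θ(·,Du) + ω(ε)`, and in particular
`‖Θ(·, D(K^ε u))‖_{L^∞(Ω)} ≤ ‖Θ(·,Du)‖_{L^∞(Ω)} + ω(ε)`. -/
theorem stmt17 {n N : ℕ} (Ω : Set (EuclideanSpace ℝ (Fin n)))
    (hΩo : IsOpen Ω) (hΩb : Bornology.IsBounded Ω)
    (ξ : EuclideanSpace ℝ (Fin n) → EuclideanSpace ℝ (Fin n))
    (hξ : ContDiff ℝ (⊤ : ℕ∞) ξ) (hξc : HasCompactSupport ξ)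
    (ℓ ε₀ : ℝ) (hℓ : 0 < ℓ) (hε₀ : 0 < ε₀)
    (htrans : ∀ ε ∈ Set.Ioo (0:ℝ) ε₀, ∀ x ∈ frontier Ω,
      2 * ε ≤ Metric.infDist (x + (ε * ℓ) • ξ x) (frontier Ω))
    (ϱ : EuclideanSpace ℝ (Fin n) → ℝ)
    (hϱs : ContDiff ℝ (⊤ : ℕ∞) ϱ) (hϱsupp : tsupport ϱ ⊆ Metric.ball 0 1)
    (hϱ0 : ∀ y, 0 ≤ ϱ y) (hϱ1 : ∫ y, ϱ y = 1)
    (Θ : EuclideanSpace ℝ (Fin n) →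
      (EuclideanSpace ℝ (Fin n) →L[ℝ] EuclideanSpace ℝ (Fin N)) → ℝ)
    (hΘcont : Continuous fun q : EuclideanSpace ℝ (Fin n) ×
      (EuclideanSpace ℝ (Fin n) →L[ℝ] EuclideanSpace ℝ (Fin N)) => Θ q.1 q.2)
    (hΘconv : ∀ x, ConvexOn ℝ Set.univ (Θ x))
    (hΘ0 : ∀ x, Θ x 0 = 0) (hΘnn : ∀ x P, 0 ≤ Θ x P)
    (DΘ : EuclideanSpace ℝ (Fin n) →
      (EuclideanSpace ℝ (Fin n) →L[ℝ] EuclideanSpace ℝ (Fin N)) →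
      ((EuclideanSpace ℝ (Fin n) →L[ℝ] EuclideanSpace ℝ (Fin N)) →L[ℝ] ℝ))
    (hDΘ : ∀ x P, HasFDerivAt (Θ x) (DΘ x P) P)
    (hDΘcont : Continuous fun q : EuclideanSpace ℝ (Fin n) ×
      (EuclideanSpace ℝ (Fin n) →L[ℝ] EuclideanSpace ℝ (Fin N)) => DΘ q.1 q.2)
    (u : EuclideanSpace ℝ (Fin n) → EuclideanSpace ℝ (Fin N))
    (L : ℝ≥0) (hu : LipschitzWith L u) (hu0 : ∀ x ∉ Ω, u x = 0)
    (Du : EuclideanSpace ℝ (Fin n) →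
      (EuclideanSpace ℝ (Fin n) →L[ℝ] EuclideanSpace ℝ (Fin N)))
    (hDu : ∀ᵐ x ∂volume, HasFDerivAt u (Du x) x)
    (Ku : ℝ → EuclideanSpace ℝ (Fin n) → EuclideanSpace ℝ (Fin N))
    (hKu : Ku = fun ε x => ∫ y, ϱ y • u (x + (ε * ℓ) • ξ x - ε • y)) :
    ∃ ω : ℝ → ℝ, Continuous ω ∧ ω 0 = 0 ∧ Monotone ω ∧ (∀ t, 0 ≤ ω t) ∧
      ∀ ε ∈ Set.Ioo (0:ℝ) ε₀,
        (∀ x ∈ Ω,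
          Θ x (fderiv ℝ (Ku ε) x) ≤
            essSup (fun z => Θ z (Du z))
              (volume.restrict (Ω ∩ Metric.ball (x + (ε * ℓ) • ξ x) ε)) + ω ε) ∧
        essSup (fun x => Θ x (fderiv ℝ (Ku ε) x)) (volume.restrict Ω) ≤
          essSup (fun z => Θ z (Du z)) (volume.restrict Ω) + ω ε := by
  obtain ⟨C, hC⟩ := hξ.lipschitzWith_of_hasCompactSupport hξc (by simp)
  obtain ⟨M, hM⟩ := hξc.exists_bound_of_continuous hξ.continuous
  have hM0 : 0 ≤ M := (norm_nonneg _).trans (hM 0)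
  have hK : IsCompact (closure Ω ×ˢ Metric.closedBall
      (0 : EuclideanSpace ℝ (Fin n) →L[ℝ] EuclideanSpace ℝ (Fin N)) L) :=
    hΩb.isCompact_closure.prod (isCompact_closedBall 0 _)
  obtain ⟨ω, hωc, hω0, hωm, hωn, hω⟩ := hΘcont.exists_modulus_of_isCompact hK
  obtain ⟨B, hB⟩ := (hK.image hΘcont).bddAbove
  have hDuL : ∀ᵐ z ∂volume, ‖Du z‖ ≤ L := hDu.mono fun z hz => hz.le_of_lipschitz hu
  have hΘB : ∀ᵐ z ∂volume, z ∈ Ω → Θ z (Du z) ≤ B := by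
    filter_upwards [hDuL] with z hz hzΩ
    exact hB ⟨(z, Du z), ⟨subset_closure hzΩ, by simpa using hz⟩, rfl⟩
  have hess : ∀ s ⊆ Ω, MeasurableSet s → ∀ᵐ z ∂volume, z ∈ s →
      Θ z (Du z) ≤ essSup (fun z => Θ z (Du z)) (volume.restrict s) := by
    intro s hs hsm
    rw [← ae_restrict_iff' hsm]
    refine ae_le_essSup (Filter.isBoundedUnder_of_eventually_le (a := B) ?_)
    rw [ae_restrict_iff' hsm]
    exact hΘB.mono fun z hz h => hz (hs h)
  have hDu0 : ∀ᵐ z ∂volume, z ∈ Ωᶜ → Du z = 0 :=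
    ae_fderiv_eq_zero_of_eqOn_zero hΩo.measurableSet.compl hu0 hDu
  have hnn : ∀ s, 0 ≤ essSup (fun z => Θ z (Du z)) (volume.restrict s) := fun s =>
    essSup_nonneg_of_nonneg fun z => hΘnn z _
  set c : ℝ := max (1 + ℓ * M) (L * (ℓ * C)) with hc
  have hc0 : 0 ≤ c := le_max_of_le_left (by positivity)
  have hϱc : HasCompactSupport ϱ :=
    (isCompact_closedBall 0 1).of_isClosed_subset (isClosed_tsupport ϱ)
      (hϱsupp.trans Metric.ball_subset_closedBall)
  have hϱi : Integrable ϱ := hϱs.continuous.integrable_of_hasCompactSupport hϱc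
  have main : ∀ ε ∈ Set.Ioo (0 : ℝ) ε₀, ∀ x, Θ x (fderiv ℝ (Ku ε) x) ≤
      essSup (fun z => Θ z (Du z))
        (volume.restrict (Ω ∩ Metric.ball (x + (ε * ℓ) • ξ x) ε)) + ω (c * ε) := by
    intro ε hε x
    have hε0 : 0 < ε := hε.1
    set w := x + (ε * ℓ) • ξ x with hw
    set T : EuclideanSpace ℝ (Fin n) →L[ℝ] EuclideanSpace ℝ (Fin n) :=
      .id ℝ _ + (ε * ℓ) • fderiv ℝ ξ x with hT
    have hg' : HasFDerivAt (fun x => x + (ε * ℓ) • ξ x) T x :=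
      (hasFDerivAt_id x).add (((hξ.differentiable (by simp)) x).hasFDerivAt.fun_const_smul _)
    have hg : LipschitzWith (1 + ‖ε * ℓ‖₊ * C) (fun x => x + (ε * ℓ) • ξ x) :=
      LipschitzWith.id.add ((lipschitzWith_smul (ε * ℓ)).comp hC)
    obtain ⟨hint, hder⟩ := hasFDerivAt_integral_smul_comp_sub_smul hϱi hϱc hϱs.continuous hu hDu
      hg hg' hε0.ne'
    have hKx : fderiv ℝ (Ku ε) x = ∫ y, ϱ y • (Du (w - ε • y)).comp T := by
      rw [hKu]
      exact hder.fderiv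
    set m := essSup (fun z => Θ z (Du z)) (volume.restrict (Ω ∩ Metric.ball w ε)) with hm
    have hconv : Convex ℝ {P | Θ x P ≤ m + ω (c * ε)} := by
      simpa using (hΘconv x).convex_le (m + ω (c * ε))
    have hΘx : Continuous (Θ x) := hΘcont.comp (Continuous.prodMk_right x)
    have hq := quasiMeasurePreserving_sub_smul (μ := volume) w hε0.ne'
    rw [hKx]
    refine hconv.integral_smul_mem (isClosed_le hΘx continuous_const) hϱs.continuous.measurable
      hϱ0 hϱ1 hint ?_
    filter_upwards [hq.ae hDuL, hq.ae hDu0, hq.ae (hess _ Set.inter_subset_left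
      (hΩo.measurableSet.inter Metric.isOpen_ball.measurableSet))] with y hyL hy0 hym hϱy
    have hy1 : ‖y‖ < 1 := by simpa using hϱsupp (subset_tsupport ϱ hϱy)
    by_cases hz : w - ε • y ∈ Ω
    · have hball : w - ε • y ∈ Metric.ball w ε := by
        simpa [norm_smul, abs_of_pos hε0] using mul_lt_of_lt_one_right hε0 hy1
      have h1 := hym ⟨hz, hball⟩
      have h2 := hω (w - ε • y, Du (w - ε • y)) ⟨subset_closure hz, by simpa using hyL⟩
        (x, (Du (w - ε • y)).comp T)
      have hd : dist (x, (Du (w - ε • y)).comp T) (w - ε • y, Du (w - ε • y)) ≤ c * ε := by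
        rw [Prod.dist_eq, hc, max_mul_of_nonneg _ _ hε0.le]
        refine max_le_max ?_ ?_
        · calc dist x (w - ε • y) = ‖ε • y - (ε * ℓ) • ξ x‖ := by
                rw [dist_eq_norm, hw]; congr 1; abel
            _ ≤ ‖ε • y‖ + ‖(ε * ℓ) • ξ x‖ := norm_sub_le _ _
            _ = ε * ‖y‖ + ε * ℓ * ‖ξ x‖ := by
                rw [norm_smul, norm_smul, Real.norm_of_nonneg hε0.le,
                  Real.norm_of_nonneg (by positivity)]
            _ ≤ ε * 1 + ε * ℓ * M := by gcongr; exact hM x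
            _ = (1 + ℓ * M) * ε := by ring
        · calc dist ((Du (w - ε • y)).comp T) (Du (w - ε • y))
              = ‖(Du (w - ε • y)).comp ((ε * ℓ) • fderiv ℝ ξ x)‖ := by
                rw [dist_eq_norm, hT, ContinuousLinearMap.comp_add,
                  ContinuousLinearMap.comp_id, add_sub_cancel_left]
            _ ≤ ‖Du (w - ε • y)‖ * ‖(ε * ℓ) • fderiv ℝ ξ x‖ :=
                ContinuousLinearMap.opNorm_comp_le _ _
            _ = ‖Du (w - ε • y)‖ * (ε * ℓ * ‖fderiv ℝ ξ x‖) := by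
                rw [norm_smul, Real.norm_of_nonneg (by positivity)]
            _ ≤ L * (ε * ℓ * C) := by
                gcongr
                exact norm_fderiv_le_of_lipschitz ℝ hC
            _ = L * (ℓ * C) * ε := by ring
      have h3 := (le_abs_self _).trans (h2.trans (hωm hd))
      show Θ x _ ≤ _
      simp only at h3
      linarith
    · show Θ x _ ≤ _
      rw [hy0 hz, ContinuousLinearMap.zero_comp, hΘ0]
      exact add_nonneg (hnn _) (hωn _)
  refine ⟨fun t => ω (c * t), by fun_prop, by simpa using hω0,
    fun s t hst => hωm (mul_le_mul_of_nonneg_left hst hc0), fun t => hωn _,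
    fun ε hε => ⟨fun x _ => main ε hε x, ?_⟩⟩
  refine essSup_le_of_ae_le_of_nonneg (add_nonneg (hnn _) (hωn _))
    (Filter.Eventually.of_forall fun x => (main ε hε x).trans ?_)
  gcongr
  refine essSup_le_of_ae_le_of_nonneg (hnn _) ?_
  rw [ae_restrict_iff' (hΩo.measurableSet.inter Metric.isOpen_ball.measurableSet)]
  exact (hess Ω subset_rfl hΩo.measurableSet).mono fun z hz h => hz h.1
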